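/- In the Blocksworld domain with goal On(x,y) for fixed distinct blocks x and y, the optimal value function satisfies, for every well-formed state s: if On(x,y) holds (x sits directly on y) then V*(s) = 0, and otherwise V*(s) = [the gripper holds a block] + 2·[not (y is clear and the gripper holds x)] + 2a·[x is not above y] + 2b·[y is not above x], where a is the number of blocks above x in s, b is the number of blocks above y in s, 'above' is the transitive closure of the on-relation, and [·] is 1 if the condition holds and 0 otherwise. -/

import Mathlib

open scoped Classical

/-- A (raw) Blocksworld state over a set `B` of blocks: `onb b = some b'` says
that `b` sits directly on `b'` (`onb b = none`: `b` is on the table or held),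
and `hold` is the content of the gripper. -/
structure BW (B : Type*) where
  onb : B → Option B
  hold : Option B

/-- `Above s a b`: block `a` is (somewhere) above block `b`, i.e., the
transitive closure of the on-relation. -/
def Above {B : Type*} (s : BW B) : B → B → Prop :=
  Relation.TransGen (fun u v => s.onb u = some v)

/-- A block is clear if no block is on it and it is not held. -/
def ClearB {B : Type*} (s : BW B) (b : B) : Prop :=
  (∀ b', s.onb b' ≠ some b) ∧ s.hold ≠ some b

/-- Well-formedness of a Blocksworld state: the held block (if any) is not on
any block and no block is on it, no two distinct blocks are on the same block,
and the `Above` relation is irreflexive. -/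
def WFBW {B : Type*} (s : BW B) : Prop :=
  (∀ b, s.hold = some b → s.onb b = none) ∧
  (∀ b b', s.hold = some b → s.onb b' ≠ some b) ∧
  (∀ b₁ b₂ b, s.onb b₁ = some b → s.onb b₂ = some b → b₁ = b₂) ∧
  (∀ b, ¬ Above s b b)

/-- The Blocksworld actions: pick up a clear block when the gripper is empty
(removing its on-fact, if any), put the held block down onto the table, or put
the held block down onto a clear block. -/
inductive BWStep {B : Type*} [DecidableEq B] : BW B → BW B → Prop
  | pickup (s : BW B) (b : B) (h1 : s.hold = none) (h2 : ClearB s b) :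
      BWStep s ⟨fun b' => if b' = b then none else s.onb b', some b⟩
  | putTable (s : BW B) (b : B) (h : s.hold = some b) :
      BWStep s ⟨s.onb, none⟩
  | putOn (s : BW B) (b c : B) (h : s.hold = some b)
      (hc : ∀ b', s.onb b' ≠ some c) (hbc : b ≠ c) :
      BWStep s ⟨Function.update s.onb b (some c), none⟩

/-- The set of lengths of plans from state `s` to the goal condition `Goal`:
`n` belongs to it iff some sequence of `n` actions transforms `s` into a state
satisfying `Goal`.  The optimal value `V*(s)` is the least element of this
set. -/
def BWPlanLengths {B : Type*} [DecidableEq B] (s : BW B) (Goal : BW B → Prop) :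
    Set ℕ :=
  {n | ∃ τ : ℕ → BW B, τ 0 = s ∧ (∀ i < n, BWStep (τ i) (τ (i + 1))) ∧ Goal (τ n)}


section BWHelpers

variable {B : Type*} [Fintype B] [DecidableEq B]

noncomputable def bwV (x y : B) (s : BW B) : ℕ :=
      (if s.onb x = some y then 0 else
        (if s.hold ≠ none then 1 else 0) +
        (if ¬ (ClearB s y ∧ s.hold = some x) then 2 else 0) +
        (if ¬ Above s x y then 2 * {b | Above s b x}.ncard else 0) +
        (if ¬ Above s y x then 2 * {b | Above s b y}.ncard else 0))

def bwPick (s : BW B) (b : B) : BW B :=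
  ⟨fun b' => if b' = b then none else s.onb b', some b⟩

lemma bw_above_target {s : BW B} {u v : B} (h : Above s u v) : ∃ w, s.onb w = some v := by
  cases h with
  | single h => exact ⟨_, h⟩
  | tail _ h => exact ⟨_, h⟩

lemma bw_above_source {s : BW B} {u v : B} (h : Above s u v) :
    ∃ w, s.onb u = some w ∧ (w = v ∨ Above s w v) := by
  rcases Relation.TransGen.head'_iff.1 h with ⟨w, h1, h2⟩
  refine ⟨w, h1, ?_⟩
  rcases Relation.reflTransGen_iff_eq_or_transGen.1 h2 with h | h
  · exact Or.inl h.symm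
  · exact Or.inr h

lemma bw_above_total {s : BW B} {u v w : B} (h : Above s u v) (h' : Above s u w) :
    v = w ∨ Above s v w ∨ Above s w v := by
  have hU : Relator.RightUnique (fun u v => s.onb u = some v) := by
    intro a b c h1 h2
    simpa [h1] using h2
  rcases Relation.ReflTransGen.total_of_right_unique hU h.to_reflTransGen h'.to_reflTransGen with h | h
  · rcases Relation.reflTransGen_iff_eq_or_transGen.1 h with h | h
    · exact Or.inl h.symm
    · exact Or.inr (Or.inl h)
  · rcases Relation.reflTransGen_iff_eq_or_transGen.1 h with h | h
    · exact Or.inl h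
    · exact Or.inr (Or.inr h)

lemma bw_pick_above {s : BW B} {b : B} (hc : ClearB s b) (u v : B) :
    Above (bwPick s b) u v ↔ Above s u v ∧ u ≠ b := by
  constructor
  · intro h
    constructor
    · have edge : ∀ a c, (bwPick s b).onb a = some c → s.onb a = some c := by
        intro a c hac
        simp only [bwPick] at hac
        split_ifs at hac
        exact hac
      clear hc
      induction h with
      | single h => exact Relation.TransGen.single (edge _ _ h)
      | tail _ h2 ih => exact Relation.TransGen.tail ih (edge _ _ h2)
    · rintro rfl
      obtain ⟨w, hw, _⟩ := bw_above_source h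
      simp [bwPick] at hw
  · rintro ⟨h, hne⟩
    have key : ∀ v, Above s u v → Above (bwPick s b) u v := by
      intro v h
      induction h with
      | single h => exact Relation.TransGen.single (by simp [bwPick, hne, h])
      | tail h1 h2 ih =>
        rename_i c d
        have : c ≠ b := by
          rintro rfl
          obtain ⟨w, hw⟩ := bw_above_target h1
          exact hc.1 _ hw
        exact Relation.TransGen.tail ih (by simp [bwPick, this, h2])
    exact key v h

lemma bw_pick_wf {s : BW B} (hs : WFBW s) {b : B} (hc : ClearB s b) : WFBW (bwPick s b) := by
  obtain ⟨h1, h2, h3, h4⟩ := hs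
  refine ⟨?_, ?_, ?_, ?_⟩
  · intro c hcc
    simp only [bwPick, Option.some.injEq] at hcc
    simp [bwPick, hcc]
  · intro c d hcc
    simp only [bwPick, Option.some.injEq] at hcc
    subst hcc
    simp only [bwPick]
    split_ifs
    · simp
    · exact hc.1 d
  · intro c d e hce hde
    simp only [bwPick] at hce hde
    split_ifs at hce hde
    exact h3 _ _ _ hce hde
  · intro c hcc
    exact h4 c ((bw_pick_above hc c c).1 hcc).1

/-- Every step is a pickup or the reverse of one. -/
lemma bw_step_cases {s t : BW B} (hs : WFBW s) (h : BWStep s t) :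
    WFBW t ∧ ((∃ b, s.hold = none ∧ ClearB s b ∧ t = bwPick s b) ∨
      (∃ b, t.hold = none ∧ ClearB t b ∧ s = bwPick t b)) := by
  cases h with
  | pickup b h1 h2 => exact ⟨bw_pick_wf hs h2, Or.inl ⟨b, h1, h2, rfl⟩⟩
  | putTable b h =>
    obtain ⟨h1, h2, h3, h4⟩ := hs
    refine ⟨⟨by simp, by simp, h3, h4⟩, Or.inr ⟨b, rfl, ⟨fun b' => h2 b b' h, by simp⟩, ?_⟩⟩
    cases s with
    | mk o hd =>
      simp only at h h1
      simp only [bwPick, h, BW.mk.injEq, and_true]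
      funext b'
      split_ifs with hb
      · rw [hb]; exact h1 b h
      · rfl
  | putOn b c h hc hbc =>
    obtain ⟨h1, h2, h3, h4⟩ := hs
    refine ⟨⟨by simp, by simp, ?_, ?_⟩, Or.inr ⟨b, rfl, ⟨?_, by simp⟩, ?_⟩⟩
    · intro d e f hd he
      simp only [Function.update_apply] at hd he
      grind
    · intro u hu
      have key : ∀ v, Above ⟨Function.update s.onb b (some c), none⟩ u v →
          Above s u v ∨ (u = b ∧ v ≠ b) := by
        intro v h'
        induction h' with
        | single h' =>
          simp only [Function.update_apply] at h'
          split_ifs at h' with hb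
          · right; grind
          · left; exact Relation.TransGen.single h'
        | tail h1' h2' ih =>
          rename_i d e
          simp only [Function.update_apply] at h2'
          split_ifs at h2' with hb
          · subst hb
            rcases ih with ih | ih
            · obtain ⟨w, hw⟩ := bw_above_target ih
              exact absurd hw (h2 _ _ h)
            · exact absurd rfl ih.2
          · rcases ih with ih | ih
            · left; exact Relation.TransGen.tail ih h2'
            · right
              refine ⟨ih.1, ?_⟩
              rintro rfl
              exact h2 _ _ h h2'
      rcases key u hu with h' | h'
      · exact h4 u h'
      · exact h'.2 h'.1
    · intro b'
      simp only [Function.update_apply]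
      have := h2 b b' h
      grind
    · cases s with
      | mk o hd =>
        simp only at h h1
        simp only [bwPick, h, BW.mk.injEq, and_true]
        funext b'
        split_ifs with hb
        · rw [hb]; exact h1 b h
        · simp [hb]

lemma bw_pick_ncard {s : BW B} {b : B} (hc : ClearB s b) (v : B) :
    {u | Above s u v}.ncard = {u | Above (bwPick s b) u v}.ncard + (if Above s b v then 1 else 0) := by
  have h : {u | Above (bwPick s b) u v} = {u | Above s u v} \ {b} := by
    ext u
    simp [bw_pick_above hc]
  rw [h]
  split_ifs with hb
  · exact (Set.ncard_sdiff_singleton_add_one (s := {u | Above s u v}) hb (Set.toFinite _)).symm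
  · rw [Set.sdiff_singleton_eq_self (s := {u | Above s u v}) hb, add_zero]

lemma bw_ncard_zero (s : BW B) (v : B) :
    {u | Above s u v}.ncard = 0 ↔ ∀ u, s.onb u ≠ some v := by
  rw [Set.ncard_eq_zero (Set.toFinite _), Set.eq_empty_iff_forall_notMem]
  constructor
  · intro h u hu
    exact h u (Relation.TransGen.single hu)
  · intro h u hu
    obtain ⟨w, hw⟩ := bw_above_target hu
    exact h w hw

/-- Basic facts relating a state and its pickup successor. -/
lemma bw_pick_dist {x y : B} (hxy : x ≠ y) {s : BW B} (hs : WFBW s) {b : B}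
    (hh : s.hold = none) (hc : ClearB s b) :
    bwV x y s ≤ bwV x y (bwPick s b) + 1 ∧ bwV x y (bwPick s b) ≤ bwV x y s + 1 := by
  have hA := bw_pick_ncard hc x
  have hB := bw_pick_ncard hc y
  have zA := bw_ncard_zero s x
  have zB := bw_ncard_zero s y
  have zB' := bw_ncard_zero (bwPick s b) y
  have axy := bw_pick_above hc x y
  have ayx := bw_pick_above hc y x
  have anti : ¬ (Above s x y ∧ Above s y x) := fun h => hs.2.2.2 x (h.1.trans h.2)
  have tot : Above s b x → Above s b y → Above s x y ∨ Above s y x := by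
    intro h1 h2
    rcases bw_above_total h1 h2 with h | h
    · exact absurd h hxy
    · exact h
  have nob : ∀ v, ¬ Above s v b := by
    intro v hv
    obtain ⟨w, hw⟩ := bw_above_target hv
    exact hc.1 _ hw
  have e1 : (bwPick s b).onb x = if x = b then none else s.onb x := rfl
  have e2 : (bwPick s b).hold = some b := rfl
  have cl : ClearB (bwPick s b) y ↔ {u | Above (bwPick s b) u y}.ncard = 0 ∧ b ≠ y := by
    rw [zB']; simp [ClearB, e2]
  have g1 : s.onb x = some y → Above s x y := fun h => Relation.TransGen.single h
  have g2 : s.onb x = some y → b = x → {u | Above (bwPick s b) u y}.ncard = 0 := by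
    rintro h rfl
    rw [zB']
    intro u hu
    simp only [bwPick] at hu
    split_ifs at hu with hub
    exact hub (hs.2.2.1 _ _ _ hu h)
  have g3 : s.onb x ≠ some y → Above s x y → b = x → {u | Above (bwPick s b) u y}.ncard ≠ 0 := by
    rintro h hab rfl h0
    rw [zB'] at h0
    obtain ⟨w, hw, hwy⟩ := bw_above_source hab
    rcases hwy with rfl | hwy
    · exact h hw
    · have : Above (bwPick s b) w y := (bw_pick_above hc w y).2 ⟨hwy, by
        rintro rfl
        exact nob _ (Relation.TransGen.single hw)⟩
      obtain ⟨z, hz⟩ := bw_above_target this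
      exact h0 z hz
  have z3 : b = x → {u | Above s u x}.ncard = 0 := by
    rintro rfl; exact zA.2 hc.1
  have z4 : b = y → {u | Above s u y}.ncard = 0 := by
    rintro rfl; exact zB.2 hc.1
  have nx := nob x
  have ny := nob y
  have nbb : ∀ v, ¬ Above s v v := hs.2.2.2
  have nxx := nbb x
  have nyy := nbb y
  unfold bwV
  rw [hh, e2, e1]
  clear zA zB zB' nob nbb e1 e2 hs
  generalize {u | Above (bwPick s b) u y}.ncard = p at *
  generalize {u | Above (bwPick s b) u x}.ncard = q at *
  generalize {u | Above s u y}.ncard = p' at *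
  generalize {u | Above s u x}.ncard = q' at *
  by_cases hbx : b = x
  · subst hbx
    grind
  · by_cases hby : b = y
    · subst hby
      grind
    · grind

lemma bw_exists_top {s : BW B} (hs : WFBW s) (hh : s.hold = none) {v : B}
    (h : {u | Above s u v}.ncard ≠ 0) : ∃ b, Above s b v ∧ ClearB s b := by
  have hne : {u | Above s u v}.Nonempty := Set.nonempty_of_ncard_ne_zero h
  have : IsTrans B (Above s) := ⟨fun _ _ _ h1 h2 => h1.trans h2⟩
  have : Std.Irrefl (Above s) := ⟨hs.2.2.2⟩
  have wf : WellFounded (Above s) := Finite.wellFounded_of_trans_of_irrefl _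
  obtain ⟨m, hm, hmin⟩ := wf.has_min _ hne
  refine ⟨m, hm, ?_, by simp [hh]⟩
  intro b' hb'
  have h1 : Above s b' m := Relation.TransGen.single hb'
  exact hmin b' (h1.trans hm) h1

lemma bw_progress {x y : B} (hxy : x ≠ y) {s : BW B} (hs : WFBW s) (hg : s.onb x ≠ some y) :
    ∃ t, BWStep s t ∧ bwV x y t < bwV x y s := by
  rcases hh : s.hold with _ | b
  · -- empty gripper
    have anti : ¬ (Above s x y ∧ Above s y x) := fun h => hs.2.2.2 x (h.1.trans h.2)
    have nxx := hs.2.2.2 x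
    have nyy := hs.2.2.2 y
    have pick : ∀ b, ClearB s b → b = x ∨ Above s b x ∨ Above s b y →
        ((¬ Above s x y ∧ Above s b x) ∨
         ((Above s x y ∨ {u | Above s u x}.ncard = 0) ∧ ¬ Above s y x ∧ Above s b y) ∨
         (b = x ∧ {u | Above s u x}.ncard = 0 ∧ {u | Above s u y}.ncard = 0)) →
        bwV x y (bwPick s b) < bwV x y s := by
      intro b hc _ hcase
      have hA := bw_pick_ncard hc x
      have hB := bw_pick_ncard hc y
      have axy := bw_pick_above hc x y
      have ayx := bw_pick_above hc y x
      have zB' := bw_ncard_zero (bwPick s b) y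
      have e1 : (bwPick s b).onb x = if x = b then none else s.onb x := rfl
      have e2 : (bwPick s b).hold = some b := rfl
      have cl : ClearB (bwPick s b) y ↔ {u | Above (bwPick s b) u y}.ncard = 0 ∧ b ≠ y := by
        rw [zB']; simp [ClearB, e2]
      have z3 : b = x → {u | Above s u x}.ncard = 0 := by
        rintro rfl; exact (bw_ncard_zero s b).2 hc.1
      have z4 : b = y → {u | Above s u y}.ncard = 0 := by
        rintro rfl; exact (bw_ncard_zero s b).2 hc.1
      have z5 : {u | Above s u y}.ncard = 0 → ¬ Above s x y := by
        intro h hab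
        obtain ⟨w, hw⟩ := bw_above_target hab
        exact (bw_ncard_zero s y).1 h _ hw
      unfold bwV
      rw [hh, e2, e1]
      clear zB' e1 e2 hs
      generalize {u | Above (bwPick s b) u y}.ncard = p at *
      generalize {u | Above (bwPick s b) u x}.ncard = q at *
      generalize {u | Above s u y}.ncard = p' at *
      generalize {u | Above s u x}.ncard = q' at *
      by_cases hbx : b = x
      · subst hbx
        grind
      · by_cases hby : b = y
        · subst hby
          grind
        · grind
    by_cases c1 : ¬ Above s x y ∧ {u | Above s u x}.ncard ≠ 0
    · obtain ⟨b, hb, hc⟩ := bw_exists_top hs hh c1.2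
      exact ⟨_, BWStep.pickup s b hh hc, pick b hc (by tauto) (by tauto)⟩
    · by_cases c2 : ¬ Above s y x ∧ {u | Above s u y}.ncard ≠ 0
      · obtain ⟨b, hb, hc⟩ := bw_exists_top hs hh c2.2
        exact ⟨_, BWStep.pickup s b hh hc, pick b hc (by tauto) (by tauto)⟩
      · have w1 : Above s x y → {u | Above s u y}.ncard ≠ 0 := by
          intro hab h
          obtain ⟨w, hw⟩ := bw_above_target hab
          exact (bw_ncard_zero s y).1 h _ hw
        have w2 : Above s y x → {u | Above s u x}.ncard ≠ 0 := by
          intro hab h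
          obtain ⟨w, hw⟩ := bw_above_target hab
          exact (bw_ncard_zero s x).1 h _ hw
        have c : {u | Above s u x}.ncard = 0 ∧ {u | Above s u y}.ncard = 0 := by tauto
        have hc : ClearB s x := ⟨(bw_ncard_zero s x).1 c.1, by simp [hh]⟩
        exact ⟨_, BWStep.pickup s x hh hc, pick x hc (by tauto) (by tauto)⟩
  · by_cases hx : ClearB s y ∧ b = x
    · obtain ⟨hc, rfl⟩ := hx
      refine ⟨_, BWStep.putOn s b y hh hc.1 hxy, ?_⟩
      have : bwV b y ⟨Function.update s.onb b (some y), none⟩ = 0 := by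
        simp [bwV]
      rw [this]
      simp only [bwV, if_neg hg, hh]
      simp
    · refine ⟨_, BWStep.putTable s b hh, ?_⟩
      have e : ∀ u v, Above (⟨s.onb, none⟩ : BW B) u v ↔ Above s u v := fun _ _ => Iff.rfl
      have hx' : ¬ (ClearB s y ∧ some b = some x) := by simpa using hx
      simp only [bwV, if_neg hg, hh, e, hx']
      simp

lemma bw_lower {x y : B} (hxy : x ≠ y) (n : ℕ) : ∀ (s : BW B), WFBW s →
    n ∈ BWPlanLengths s (fun t => t.onb x = some y) → bwV x y s ≤ n := by
  induction n with
  | zero =>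
    rintro s hs ⟨τ, h0, -, hg⟩
    subst h0
    replace hg : (τ 0).onb x = some y := hg
    simp [bwV, hg]
  | succ n ih =>
    rintro s hs ⟨τ, h0, hst, hg⟩
    have h1 := hst 0 (by omega)
    rw [h0] at h1
    obtain ⟨hwt, hcase⟩ := bw_step_cases hs h1
    have h2 := ih (τ (0 + 1)) hwt ⟨fun i => τ (i + 1), rfl, fun i hi => hst (i + 1) (by omega), hg⟩
    have h3 : bwV x y s ≤ bwV x y (τ (0 + 1)) + 1 := by
      rcases hcase with ⟨b, hb, hc, he⟩ | ⟨b, hb, hc, he⟩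
      · rw [he]; exact (bw_pick_dist hxy hs hb hc).1
      · rw [he]; exact (bw_pick_dist hxy hwt hb hc).2
    omega

lemma bw_upper {x y : B} (hxy : x ≠ y) (n : ℕ) : ∀ (s : BW B), WFBW s → bwV x y s = n →
    n ∈ BWPlanLengths s (fun t => t.onb x = some y) := by
  induction n with
  | zero =>
    intro s hs hv
    by_cases hg : s.onb x = some y
    · exact ⟨fun _ => s, rfl, by simp, hg⟩
    · obtain ⟨t, -, h⟩ := bw_progress hxy hs hg
      omega
  | succ n ih =>
    intro s hs hv
    by_cases hg : s.onb x = some y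
    · simp [bwV, hg] at hv
    · obtain ⟨t, ht, hlt⟩ := bw_progress hxy hs hg
      obtain ⟨hwt, hcase⟩ := bw_step_cases hs ht
      have h3 : bwV x y s ≤ bwV x y t + 1 := by
        rcases hcase with ⟨b, hb, hc, he⟩ | ⟨b, hb, hc, he⟩
        · rw [he]; exact (bw_pick_dist hxy hs hb hc).1
        · rw [he]; exact (bw_pick_dist hxy hwt hb hc).2
      obtain ⟨τ, h0, hst, hgl⟩ := ih t hwt (by omega)
      refine ⟨fun i => Nat.casesOn i s τ, rfl, ?_, hgl⟩
      intro i hi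
      cases i with
      | zero => simpa [h0] using ht
      | succ j => exact hst j (by omega)

end BWHelpers

/-- **Optimal value function for Blocksworld-On**: for the goal `On(x,y)` with
`x ≠ y` and every well-formed state `s`: if `x` sits directly on `y` then
`V*(s) = 0`, and otherwise
`V*(s) = [gripper holds a block] + 2·[¬(y clear ∧ gripper holds x)]
        + 2a·[x not above y] + 2b·[y not above x]`,
where `a` (resp. `b`) is the number of blocks above `x` (resp. `y`). -/
theorem blocksworld_on_optimal_value {B : Type*} [Fintype B] [DecidableEq B]
    (x y : B) (hxy : x ≠ y) (s : BW B) (hwf : WFBW s) :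
    IsLeast (BWPlanLengths s (fun t => t.onb x = some y))
      (if s.onb x = some y then 0 else
        (if s.hold ≠ none then 1 else 0) +
        (if ¬ (ClearB s y ∧ s.hold = some x) then 2 else 0) +
        (if ¬ Above s x y then 2 * {b | Above s b x}.ncard else 0) +
        (if ¬ Above s y x then 2 * {b | Above s b y}.ncard else 0)) := by
  exact ⟨bw_upper hxy _ s hwf rfl, fun n hn => bw_lower hxy n s hwf hn⟩
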